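/- Let q ≥ 1 be an integer and let X be a connected (q+1)-regular simple graph with fixed base vertex x0. Then for every vertex x and every integer t ≥ 0, the random walk heat kernel satisfies K_X^rw(x0,x;t) = (q/(q+1))^t · Σ_{k=0}^{t} C(t,k) · (−1)^k · Σ_{m=0}^{k} b_m(x) · q^{−m/2} · I_m^{−2/√q}(k), where C(t,k) is the binomial coefficient. -/

import Mathlib

open Finset

/-- The discrete `I`-Bessel function `I_n^c(t)` (real parameter `c`). -/
noncomputable def besselI (c : ℝ) (n t : ℕ) : ℝ :=
  if n ≤ t then
    ∑ j ∈ Finset.range ((t - n) / 2 + 1),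
      (t.factorial : ℝ) /
          ((j.factorial : ℝ) * ((t - 2 * j - n).factorial : ℝ) * ((n + j).factorial : ℝ)) *
        (c / 2) ^ (2 * j + n)
  else 0

/-- A walk is non-backtracking if no step is immediately followed by the reverse step. -/
def Nonbacktracking {V : Type*} {G : SimpleGraph V} {u v : V} (p : G.Walk u v) : Prop :=
  List.Chain' (fun d₁ d₂ => d₂ ≠ d₁.symm) p.darts

/-- `cCount G x0 x m` is the number of non-backtracking walks of length `m` from `x0` to `x`. -/
noncomputable def cCount {V : Type*} (G : SimpleGraph V) (x0 x : V) (m : ℕ) : ℕ :=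
  Nat.card {p : G.Walk x0 x // p.length = m ∧ Nonbacktracking p}

/-- The coefficients `b_m(x)`:  `b_m(x) = c_m(x) - (q-1)(c_{m-2}(x) + c_{m-4}(x) + ⋯ + c_*(x))`,
where the sum goes down to `c_0(x)` for even `m` and `c_1(x)` for odd `m`. -/
noncomputable def bCoef {V : Type*} (q : ℕ) (G : SimpleGraph V) (x0 x : V) (m : ℕ) : ℝ :=
  (cCount G x0 x m : ℝ) -
    ((q : ℝ) - 1) * ∑ k ∈ Finset.Icc 1 (m / 2), (cCount G x0 x (m - 2 * k) : ℝ)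

section Bessel

lemma besselI_eq_sum_choose (c : ℝ) (n t N : ℕ) (hN : t < N) :
    besselI c n t = ∑ j ∈ range N,
      (t.choose (2 * j + n) : ℝ) * ((2 * j + n).choose j : ℝ) * (c / 2) ^ (2 * j + n) := by
  have hzero : ∀ j, t < 2 * j + n →
      (t.choose (2 * j + n) : ℝ) * ((2 * j + n).choose j : ℝ) * (c / 2) ^ (2 * j + n) = 0 := by
    intro j hj
    rw [Nat.choose_eq_zero_of_lt hj]
    simp
  unfold besselI
  split_ifs with h
  · have hsub : range ((t - n) / 2 + 1) ⊆ range N := by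
      intro j hj
      simp only [mem_range] at hj ⊢
      omega
    rw [← sum_subset hsub]
    · refine sum_congr rfl fun j hj => ?_
      simp only [mem_range] at hj
      have h1 : 2 * j + n ≤ t := by omega
      have h2 : j ≤ 2 * j + n := by omega
      rw [Nat.cast_choose ℝ h1, Nat.cast_choose ℝ h2]
      have e1 : t - (2 * j + n) = t - 2 * j - n := by omega
      have e2 : 2 * j + n - j = n + j := by omega
      rw [e1, e2]
      have h3 : ((2 * j + n).factorial : ℝ) ≠ 0 := by positivity
      congr 1
      field_simp
    · intro j _ hj
      simp only [mem_range] at hj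
      exact hzero j (by omega)
  · exact (sum_eq_zero fun j _ => hzero j (by omega)).symm

lemma besselI_eq_zero (c : ℝ) {n t : ℕ} (h : t < n) : besselI c n t = 0 := by
  rw [besselI, if_neg (by omega)]

lemma besselI_zero_succ (c : ℝ) (t : ℕ) :
    besselI c 0 (t + 1) = besselI c 0 t + c / 2 * (2 * besselI c 1 t) := by
  rw [besselI_eq_sum_choose c 0 (t + 1) (t + 3) (by omega),
    besselI_eq_sum_choose c 0 t (t + 3) (by omega),
    besselI_eq_sum_choose c 1 t (t + 2) (by omega),
    sum_range_succ' _ (t + 2), sum_range_succ' _ (t + 2), mul_sum, mul_sum, add_right_comm,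
    ← sum_add_distrib]
  congr 1
  · refine sum_congr rfl fun j _ => ?_
    have h1 : (t + 1).choose (2 * (j + 1) + 0)
        = t.choose (2 * j + 1) + t.choose (2 * (j + 1) + 0) := Nat.choose_succ_succ' _ _
    have h2 : (2 * (j + 1) + 0).choose (j + 1) = 2 * (2 * j + 1).choose j := by
      have h3 : (2 * (j + 1) + 0).choose (j + 1)
          = (2 * j + 1).choose j + (2 * j + 1).choose (j + 1) := Nat.choose_succ_succ' _ _
      have h4 : (2 * j + 1).choose (j + 1) = (2 * j + 1).choose j :=
        Nat.choose_symm_of_eq_add (by omega)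
      omega
    rw [h1, h2]
    push_cast
    ring
  · simp

lemma besselI_succ_succ (c : ℝ) (n t : ℕ) :
    besselI c (n + 1) (t + 1) =
      besselI c (n + 1) t + c / 2 * (besselI c n t + besselI c (n + 2) t) := by
  rw [besselI_eq_sum_choose c (n + 1) (t + 1) (t + 3) (by omega),
    besselI_eq_sum_choose c (n + 1) t (t + 3) (by omega),
    besselI_eq_sum_choose c n t (t + 3) (by omega),
    besselI_eq_sum_choose c (n + 2) t (t + 2) (by omega),
    sum_range_succ' _ (t + 2), sum_range_succ' _ (t + 2), sum_range_succ' _ (t + 2)]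
  have hterm : ∀ j ∈ range (t + 2),
      ((t + 1).choose (2 * (j + 1) + (n + 1)) : ℝ) * ((2 * (j + 1) + (n + 1)).choose (j + 1) : ℝ) *
          (c / 2) ^ (2 * (j + 1) + (n + 1)) =
        (t.choose (2 * (j + 1) + (n + 1)) : ℝ) * ((2 * (j + 1) + (n + 1)).choose (j + 1) : ℝ) *
          (c / 2) ^ (2 * (j + 1) + (n + 1)) +
        c / 2 * ((t.choose (2 * (j + 1) + n) : ℝ) * ((2 * (j + 1) + n).choose (j + 1) : ℝ) *
          (c / 2) ^ (2 * (j + 1) + n) +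
          (t.choose (2 * j + (n + 2)) : ℝ) * ((2 * j + (n + 2)).choose j : ℝ) *
          (c / 2) ^ (2 * j + (n + 2))) := by
    intro j _
    have e : 2 * (j + 1) + n = 2 * j + (n + 2) := by ring
    have h1 : (t + 1).choose (2 * (j + 1) + (n + 1))
        = t.choose (2 * j + (n + 2)) + t.choose (2 * (j + 1) + (n + 1)) := by
      rw [← e]
      exact Nat.choose_succ_succ' _ _
    have h2 : (2 * (j + 1) + (n + 1)).choose (j + 1)
        = (2 * j + (n + 2)).choose j + (2 * j + (n + 2)).choose (j + 1) := by
      rw [← e]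
      exact Nat.choose_succ_succ' _ _
    rw [e, h1, h2]
    push_cast
    ring
  rw [sum_congr rfl hterm, sum_add_distrib, ← mul_sum, sum_add_distrib]
  have h0 : (t + 1).choose (n + 1) = t.choose n + t.choose (n + 1) := Nat.choose_succ_succ' _ _
  simp only [mul_zero, zero_add, Nat.choose_zero_right, h0]
  push_cast
  ring

/-- Summation by parts for a Chebyshev-type three-term recurrence. -/
lemma sum_range_three_term (a e f g : ℕ → ℝ)
    (f0 : f 0 = e 1) (f1 : f 1 = e 2 + 2 * e 0) (f2 : ∀ m, f (m + 2) = e (m + 3) + e (m + 1))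
    (g0 : g 0 = 2 * a 1) (gs : ∀ m, g (m + 1) = a m + a (m + 2)) (N : ℕ) :
    ∑ m ∈ range (N + 2), a m * f m + a (N + 2) * e (N + 1) =
      ∑ m ∈ range (N + 2), g m * e m + a (N + 1) * e (N + 2) := by
  induction N with
  | zero =>
    simp only [sum_range_succ, range_zero, sum_empty, zero_add, f0, f1, g0, gs 0]
    ring
  | succ N ih =>
    rw [sum_range_succ, sum_range_succ (fun m => g m * e m), f2, gs]
    linear_combination ih

lemma sum_besselI_succ (c : ℝ) (e f : ℕ → ℝ)
    (f0 : f 0 = e 1) (f1 : f 1 = e 2 + 2 * e 0) (f2 : ∀ m, f (m + 2) = e (m + 3) + e (m + 1))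
    (k : ℕ) :
    ∑ m ∈ range (k + 2), e m * besselI c m (k + 1) =
      ∑ m ∈ range (k + 1), e m * besselI c m k +
        c / 2 * ∑ m ∈ range (k + 1), f m * besselI c m k := by
  let g : ℕ → ℝ := fun m => Nat.casesOn m (2 * besselI c 1 k)
    fun m => besselI c m k + besselI c (m + 2) k
  have hg : ∀ m, besselI c m (k + 1) = besselI c m k + c / 2 * g m := by
    intro m
    cases m with
    | zero => exact besselI_zero_succ c k
    | succ m => exact besselI_succ_succ c m k
  have key := sum_range_three_term (fun m => besselI c m k) e f g f0 f1 f2 rfl (fun _ => rfl) k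
  simp only [besselI_eq_zero c (show k < k + 1 by omega),
    besselI_eq_zero c (show k < k + 2 by omega), zero_mul, add_zero] at key
  have hext : ∀ h : ℕ → ℝ, ∑ m ∈ range (k + 1), h m * besselI c m k =
      ∑ m ∈ range (k + 2), besselI c m k * h m := by
    intro h
    rw [sum_range_succ _ (k + 1), besselI_eq_zero c (show k < k + 1 by omega), zero_mul, add_zero]
    exact sum_congr rfl fun m _ => mul_comm _ _
  rw [hext, hext, key, mul_sum, ← sum_add_distrib]
  refine sum_congr rfl fun m _ => ?_
  rw [hg]
  ring

lemma sum_choose_alternating_succ (S : ℕ → ℝ) (t : ℕ) :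
    ∑ k ∈ range (t + 2), ((t + 1).choose k : ℝ) * (-1) ^ k * S k =
      ∑ k ∈ range (t + 1), (t.choose k : ℝ) * (-1) ^ k * (S k - S (k + 1)) := by
  have h : ∑ k ∈ range (t + 1), (t.choose k : ℝ) * (-1) ^ k * S k =
      ∑ k ∈ range (t + 1), (t.choose (k + 1) : ℝ) * (-1) ^ (k + 1) * S (k + 1) + S 0 := by
    rw [← show ∑ k ∈ range (t + 2), (t.choose k : ℝ) * (-1) ^ k * S k =
      ∑ k ∈ range (t + 1), (t.choose k : ℝ) * (-1) ^ k * S k by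
        rw [sum_range_succ _ (t + 1), Nat.choose_succ_self]; simp]
    rw [sum_range_succ']
    simp
  simp only [mul_sub, sum_sub_distrib]
  rw [h, sum_range_succ', add_sub_right_comm, ← sum_sub_distrib]
  congr 1
  · refine sum_congr rfl fun k _ => ?_
    rw [Nat.choose_succ_succ']
    push_cast
    ring
  · simp

end Bessel

section Walks

variable {V : Type*} {G : SimpleGraph V}

lemma nonbacktracking_iff_isChain {u v : V} (p : G.Walk u v) :
    Nonbacktracking p ↔ List.IsChain (fun d₁ d₂ => d₂ ≠ d₁.symm) p.darts :=
  Iff.rfl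

lemma nonbacktracking_nil (u : V) : Nonbacktracking (.nil : G.Walk u u) :=
  List.isChain_nil

lemma nonbacktracking_cons_nil {u v : V} (h : G.Adj u v) :
    Nonbacktracking (SimpleGraph.Walk.nil.cons h) :=
  List.isChain_singleton _

lemma nonbacktracking_reverse {u v : V} (p : G.Walk u v) :
    Nonbacktracking p.reverse ↔ Nonbacktracking p := by
  rw [nonbacktracking_iff_isChain, nonbacktracking_iff_isChain, SimpleGraph.Walk.darts_reverse,
    List.isChain_reverse, List.isChain_map]
  refine iff_of_eq (congrArg (fun R => List.IsChain R p.darts) ?_)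
  funext a b
  simp [eq_comm]

lemma Nonbacktracking.of_cons {u v w : V} {h : G.Adj u v} {p : G.Walk v w}
    (hp : Nonbacktracking (p.cons h)) : Nonbacktracking p := by
  rw [nonbacktracking_iff_isChain, SimpleGraph.Walk.darts_cons] at hp
  exact hp.tail

lemma nonbacktracking_cons_cons {u v w z : V} {h : G.Adj u v} {h' : G.Adj v w} {p : G.Walk w z} :
    Nonbacktracking ((p.cons h').cons h) ↔ w ≠ u ∧ Nonbacktracking (p.cons h') := by
  simp [nonbacktracking_iff_isChain, SimpleGraph.Walk.darts_cons, List.isChain_cons_cons,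
    SimpleGraph.Dart.ext_iff]

/-- Non-backtracking walks of length `m` from `u` to `z`. -/
def nbWalks (G : SimpleGraph V) (z u : V) (m : ℕ) : Set (G.Walk u z) :=
  {p | p.length = m ∧ Nonbacktracking p}

/-- Walks of length `m` from `v` to `z` that stay non-backtracking when preceded by `h`. -/
def nbExtWalks (z : V) {u v : V} (h : G.Adj u v) (m : ℕ) : Set (G.Walk v z) :=
  {p | p.length = m ∧ Nonbacktracking (p.cons h)}

lemma cCount_eq_ncard (z u : V) (m : ℕ) : cCount G z u m = (nbWalks G z u m).ncard := by
  rw [← Nat.card_coe_set_eq]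
  refine Nat.card_congr ⟨fun p => ⟨p.1.reverse, ?_, ?_⟩, fun p => ⟨p.1.reverse, ?_, ?_⟩, ?_, ?_⟩
  · rw [SimpleGraph.Walk.length_reverse]
    exact p.2.1
  · rw [nonbacktracking_reverse]
    exact p.2.2
  · rw [SimpleGraph.Walk.length_reverse]
    exact p.2.1
  · rw [nonbacktracking_reverse]
    exact p.2.2
  · intro p
    simp
  · intro p
    simp

lemma nbExtWalks_subset (z : V) {u v : V} (h : G.Adj u v) (m : ℕ) :
    nbExtWalks z h m ⊆ nbWalks G z v m :=
  fun _ hp => ⟨hp.1, hp.2.of_cons⟩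

lemma cCount_zero [DecidableEq V] (z u : V) : cCount G z u 0 = if u = z then 1 else 0 := by
  rw [cCount_eq_ncard]
  split_ifs with h
  · subst h
    rw [Set.ncard_eq_one]
    refine ⟨.nil, Set.ext fun p => ?_⟩
    simp only [nbWalks, Set.mem_ofPred_eq, Set.mem_singleton_iff]
    constructor
    · rintro ⟨hp, _⟩
      exact (SimpleGraph.Walk.length_eq_zero_iff.mp hp).eq_nil
    · rintro rfl
      exact ⟨rfl, nonbacktracking_nil u⟩
  · convert Set.ncard_empty (G.Walk u z)
    refine Set.eq_empty_of_forall_notMem fun p hp => h ?_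
    exact SimpleGraph.Walk.eq_of_length_eq_zero hp.1

lemma ncard_nbExtWalks_zero (z : V) {u v : V} (h : G.Adj u v) :
    (nbExtWalks z h 0).ncard = cCount G z v 0 := by
  rw [cCount_eq_ncard]
  congr 1
  refine (nbExtWalks_subset z h 0).antisymm fun p hp => ⟨hp.1, ?_⟩
  cases p with
  | nil => exact nonbacktracking_cons_nil h
  | cons h' p => simp [nbWalks] at hp

lemma sum_neighborFinset_eq [G.LocallyFinite] {M : Type*} [AddCommMonoid M] (u : V) (f : V → M) :
    ∑ y ∈ G.neighborFinset u, f y = ∑ y : G.neighborSet u, f y :=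
  Finset.sum_subtype _ (fun y => by simp) f

variable [DecidableEq V] [G.LocallyFinite]

lemma finite_nbWalks (z u : V) (m : ℕ) : (nbWalks G z u m).Finite :=
  (G.finsetWalkLength m u z).finite_toSet.subset fun _ hp =>
    SimpleGraph.mem_finsetWalkLength_iff.mpr hp.1

lemma finite_nbExtWalks (z : V) {u v : V} (h : G.Adj u v) (m : ℕ) : (nbExtWalks z h m).Finite :=
  (finite_nbWalks z v m).subset (nbExtWalks_subset z h m)

lemma ncard_nbExtWalks_succ (z : V) {u v : V} (h : G.Adj u v) (m : ℕ) :
    (nbExtWalks z h (m + 1)).ncard + (nbExtWalks z h.symm m).ncard = cCount G z v (m + 1) := by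
  have hdiff : nbWalks G z v (m + 1) \ nbExtWalks z h (m + 1) =
      SimpleGraph.Walk.cons h.symm '' nbExtWalks z h.symm m := by
    ext p
    constructor
    · rintro ⟨⟨hl, hp⟩, hn⟩
      cases p with
      | nil => simp at hl
      | @cons _ w _ h' p =>
        obtain rfl : w = u := by
          by_contra hw
          exact hn ⟨hl, nonbacktracking_cons_cons.mpr ⟨hw, hp⟩⟩
        exact ⟨p, ⟨by simpa using hl, hp⟩, rfl⟩
    · rintro ⟨p, ⟨hl, hp⟩, rfl⟩
      refine ⟨⟨by simpa using hl, hp⟩, fun hn => ?_⟩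
      exact (nonbacktracking_cons_cons.mp hn.2).1 rfl
  have hinj : Function.Injective (SimpleGraph.Walk.cons h.symm : G.Walk u z → G.Walk v z) := by
    intro p p' hpp
    simpa using hpp
  rw [cCount_eq_ncard, ← Set.ncard_image_of_injective _ hinj, ← hdiff, add_comm]
  exact Set.ncard_sdiff_add_ncard_of_subset (nbExtWalks_subset z h (m + 1)) (finite_nbWalks z v _)

lemma cCount_succ (z u : V) (m : ℕ) :
    cCount G z u (m + 1) = ∑ y : G.neighborSet u, (nbExtWalks z y.2 m).ncard := by
  have : ∀ y : G.neighborSet u, Finite (nbExtWalks z y.2 m) :=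
    fun y => finite_nbExtWalks z y.2 m
  rw [cCount_eq_ncard, ← Nat.card_coe_set_eq]
  simp only [← Nat.card_coe_set_eq]
  rw [← Nat.card_sigma]
  symm
  refine Nat.card_congr (Equiv.ofBijective
    (fun s : (y : G.neighborSet u) × nbExtWalks z y.2 m =>
      (⟨.cons s.1.2 s.2.1, congrArg (· + 1) s.2.2.1, s.2.2.2⟩ : nbWalks G z u (m + 1))) ⟨?_, ?_⟩)
  · rintro ⟨⟨y, hy⟩, ⟨p, hp⟩⟩ ⟨⟨y', hy'⟩, ⟨p', hp'⟩⟩ heq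
    cases heq
    rfl
  · rintro ⟨p, hl, hp⟩
    cases p with
    | nil => simp at hl
    | @cons _ w _ h p => exact ⟨⟨⟨w, h⟩, ⟨p, by simpa using hl, hp⟩⟩, rfl⟩

lemma sum_cCount_zero (z u : V) :
    ∑ y ∈ G.neighborFinset u, cCount G z y 0 = cCount G z u 1 := by
  rw [sum_neighborFinset_eq, cCount_succ]
  exact sum_congr rfl fun y _ => (ncard_nbExtWalks_zero z y.2).symm

lemma sum_cCount_succ (z u : V) (m : ℕ) :
    ∑ y ∈ G.neighborFinset u, cCount G z y (m + 1) =
      cCount G z u (m + 2) + ∑ y : G.neighborSet u, (nbExtWalks z y.2.symm m).ncard := by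
  rw [sum_neighborFinset_eq, cCount_succ, ← sum_add_distrib]
  exact sum_congr rfl fun y _ => (ncard_nbExtWalks_succ z y.2 m).symm

lemma sum_cCount_one {q : ℕ} (hreg : G.IsRegularOfDegree (q + 1)) (z u : V) :
    ∑ y ∈ G.neighborFinset u, cCount G z y 1 = cCount G z u 2 + (q + 1) * cCount G z u 0 := by
  rw [sum_cCount_succ]
  simp only [ncard_nbExtWalks_zero, sum_const, card_univ, SimpleGraph.card_neighborSet_eq_degree,
    hreg u, smul_eq_mul]

lemma sum_cCount_add_two {q : ℕ} (hreg : G.IsRegularOfDegree (q + 1)) (z u : V) (m : ℕ) :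
    ∑ y ∈ G.neighborFinset u, cCount G z y (m + 2) =
      cCount G z u (m + 3) + q * cCount G z u (m + 1) := by
  rw [sum_cCount_succ]
  have h : ∑ y : G.neighborSet u, ((nbExtWalks z y.2.symm (m + 1)).ncard +
      (nbExtWalks z y.2 m).ncard) = (q + 1) * cCount G z u (m + 1) := by
    rw [sum_congr rfl fun y _ => ncard_nbExtWalks_succ z y.2.symm m]
    simp only [sum_const, card_univ, SimpleGraph.card_neighborSet_eq_degree, hreg u, smul_eq_mul]
  rw [sum_add_distrib, ← cCount_succ] at h
  linarith

end Walks

section Coefficients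

variable {V : Type*} {G : SimpleGraph V} (q : ℕ)

lemma bCoef_zero (z u : V) : bCoef q G z u 0 = cCount G z u 0 := by
  simp [bCoef]

lemma bCoef_one (z u : V) : bCoef q G z u 1 = cCount G z u 1 := by
  simp [bCoef]

lemma bCoef_add_two (z u : V) (m : ℕ) :
    bCoef q G z u (m + 2) = bCoef q G z u m + cCount G z u (m + 2) - q * cCount G z u m := by
  have h : ∑ k ∈ Icc 1 ((m + 2) / 2), (cCount G z u (m + 2 - 2 * k) : ℝ) =
      cCount G z u m + ∑ k ∈ Icc 1 (m / 2), (cCount G z u (m - 2 * k) : ℝ) := by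
    rw [← Ico_add_one_right_eq_Icc, ← Ico_add_one_right_eq_Icc, sum_Ico_eq_sum_range,
      sum_Ico_eq_sum_range, show (m + 2) / 2 + 1 - 1 = m / 2 + 1 by omega,
      show m / 2 + 1 - 1 = m / 2 by omega, sum_range_succ', add_comm]
    congr 1
    refine sum_congr rfl fun k _ => ?_
    rw [show m + 2 - 2 * (1 + (k + 1)) = m - 2 * (1 + k) by omega]
  rw [bCoef, bCoef, h]
  ring

variable [DecidableEq V] [G.LocallyFinite]

lemma sum_bCoef_zero (z u : V) :
    ∑ y ∈ G.neighborFinset u, bCoef q G z y 0 = bCoef q G z u 1 := by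
  simp only [bCoef_zero, bCoef_one]
  exact_mod_cast sum_cCount_zero z u

variable {q}

lemma sum_bCoef_one (hreg : G.IsRegularOfDegree (q + 1)) (z u : V) :
    ∑ y ∈ G.neighborFinset u, bCoef q G z y 1 =
      bCoef q G z u 2 + 2 * q * bCoef q G z u 0 := by
  have h : ∑ y ∈ G.neighborFinset u, (cCount G z y 1 : ℝ) =
      cCount G z u 2 + (q + 1) * cCount G z u 0 := by exact_mod_cast sum_cCount_one hreg z u
  simp only [bCoef_add_two q z u 0, bCoef_zero, bCoef_one, h]
  ring

lemma sum_bCoef_add_two (hreg : G.IsRegularOfDegree (q + 1)) (z u : V) (m : ℕ) :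
    ∑ y ∈ G.neighborFinset u, bCoef q G z y (m + 2) =
      bCoef q G z u (m + 3) + q * bCoef q G z u (m + 1) := by
  have hc0 : ∑ y ∈ G.neighborFinset u, (cCount G z y 0 : ℝ) = cCount G z u 1 := by
    exact_mod_cast sum_cCount_zero z u
  have hc1 : ∑ y ∈ G.neighborFinset u, (cCount G z y 1 : ℝ) =
      cCount G z u 2 + (q + 1) * cCount G z u 0 := by exact_mod_cast sum_cCount_one hreg z u
  have hc : ∀ k, ∑ y ∈ G.neighborFinset u, (cCount G z y (k + 2) : ℝ) =
      cCount G z u (k + 3) + q * cCount G z u (k + 1) := fun k => by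
    exact_mod_cast sum_cCount_add_two hreg z u k
  have hstep : ∀ k, ∑ y ∈ G.neighborFinset u, bCoef q G z y (k + 2) =
      ∑ y ∈ G.neighborFinset u, bCoef q G z y k +
        (cCount G z u (k + 3) + q * cCount G z u (k + 1)) -
        q * ∑ y ∈ G.neighborFinset u, (cCount G z y k : ℝ) := fun k => by
    simp only [bCoef_add_two, sum_sub_distrib, sum_add_distrib, ← mul_sum, hc]
  induction m using Nat.twoStepInduction with
  | zero =>
    rw [hstep, sum_bCoef_zero, hc0, bCoef_add_two q z u 1, bCoef_one]
    ring
  | one =>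
    rw [hstep, sum_bCoef_one hreg, hc1, bCoef_add_two q z u 2, bCoef_add_two q z u 0, bCoef_zero]
    ring
  | more m ih _ =>
    rw [hstep, ih, hc, bCoef_add_two q z u (m + 3), bCoef_add_two q z u (m + 1)]
    ring

/-- The series `∑ₘ b_m q^{-m/2} I_m^{-2/√q}(k)` represents the `k`-th power of `1 - A / q` applied
to the indicator of the base point, where `A` is the adjacency operator. -/
lemma sum_bCoef_besselI_succ (hq : 1 ≤ q) (hreg : G.IsRegularOfDegree (q + 1)) (z u : V) (k : ℕ) :
    ∑ m ∈ range (k + 2), bCoef q G z u m * (√q ^ m)⁻¹ * besselI (-2 / √q) m (k + 1) =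
      ∑ m ∈ range (k + 1), bCoef q G z u m * (√q ^ m)⁻¹ * besselI (-2 / √q) m k -
        1 / q * ∑ y ∈ G.neighborFinset u,
          ∑ m ∈ range (k + 1), bCoef q G z y m * (√q ^ m)⁻¹ * besselI (-2 / √q) m k := by
  have hq0 : (0 : ℝ) < q := by exact_mod_cast hq
  have hs : √(q : ℝ) ≠ 0 := (Real.sqrt_pos.mpr hq0).ne'
  have hsq : (q : ℝ) = √q ^ 2 := (Real.sq_sqrt hq0.le).symm
  have key := sum_besselI_succ (-2 / √q) (fun m => bCoef q G z u m * (√q ^ m)⁻¹)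
    (fun m => (√(q : ℝ))⁻¹ * ((∑ y ∈ G.neighborFinset u, bCoef q G z y m) * (√q ^ m)⁻¹))
    ?_ ?_ ?_ k
  · rw [key, sub_eq_add_neg]
    congr 1
    rw [sum_comm, mul_sum, mul_sum, ← sum_neg_distrib]
    refine sum_congr rfl fun m _ => ?_
    rw [← sum_mul, ← sum_mul]
    have hinv : 1 / (q : ℝ) = (√q)⁻¹ * (√q)⁻¹ := by
      rw [one_div, ← mul_inv, Real.mul_self_sqrt hq0.le]
    rw [hinv]
    ring
  · rw [sum_bCoef_zero]
    simp [mul_comm]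
  · rw [sum_bCoef_one hreg]
    generalize bCoef q G z u 2 = b2
    generalize bCoef q G z u 0 = b0
    rw [show 2 * (q : ℝ) * b0 = 2 * √q ^ 2 * b0 by rw [← hsq]]
    field_simp
  · intro m
    rw [sum_bCoef_add_two hreg]
    generalize bCoef q G z u (m + 3) = b3
    generalize bCoef q G z u (m + 1) = b1
    rw [show (q : ℝ) * b1 = √q ^ 2 * b1 by rw [← hsq]]
    field_simp
    ring

end Coefficients

theorem stmt4 {V : Type*} [DecidableEq V] (q : ℕ) (hq : 1 ≤ q) (G : SimpleGraph V)
    [G.LocallyFinite] (hconn : G.Connected) (hreg : G.IsRegularOfDegree (q + 1)) (x0 : V)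
    (Krw : V → ℕ → ℝ)
    (hKrw0 : ∀ x, Krw x 0 = if x = x0 then 1 else 0)
    (hKrwrec : ∀ x t, Krw x (t + 1) = (1 / ((q : ℝ) + 1)) * ∑ y ∈ G.neighborFinset x, Krw y t)
    (x : V) (t : ℕ) :
    Krw x t = ((q : ℝ) / ((q : ℝ) + 1)) ^ t * ∑ k ∈ Finset.range (t + 1),
      (t.choose k : ℝ) * (-1 : ℝ) ^ k * ∑ m ∈ Finset.range (k + 1),
        bCoef q G x0 x m * ((Real.sqrt q) ^ m)⁻¹ * besselI (-2 / Real.sqrt q) m k := by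
  have hq0 : (q : ℝ) ≠ 0 := by exact_mod_cast (by omega : q ≠ 0)
  induction t generalizing x with
  | zero =>
    rw [hKrw0]
    simp [besselI, bCoef_zero, cCount_zero]
  | succ t ih =>
    rw [hKrwrec, sum_choose_alternating_succ]
    simp only [ih, sum_bCoef_besselI_succ hq hreg, sub_sub_cancel, ← mul_sum]
    rw [sum_comm]
    simp only [← mul_sum, mul_left_comm _ (1 / (q : ℝ))]
    rw [pow_succ]
    field_simp
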